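/- Let n ≥ 1, m ≥ 1, 0 < p ≤ 1, and let a = (a_1,…,a_m), b = (b_1,…,b_m) ∈ ℝ^m and s_1,…,s_m > −1 satisfy p·a_j > −1 − s_j and p·b_j > n + 1 + s_j for j = 1,…,m. Set λ = (m−1)(n+1) + s_1 + ⋯ + s_m, and for f ∈ A_λ^p define (S_{a,b}f)(z_1,…,z_m) = (∏_{j=1}^m t_j^{a_j}) ∫_{ℝ^{n+1}_+} f(w) s^{−n−1+Σ_{j=1}^m b_j} (∏_{j=1}^m |z_j − w̄|^{a_j+b_j})^{−1} dy ds, where z_j = (x_j,t_j) and w = (y,s) (the integral converges absolutely). Then there is a constant C > 0 such that ∫_{ℝ^{n+1}_+}⋯∫_{ℝ^{n+1}_+} |(S_{a,b}f)(z_1,…,z_m)|^p dm_{s_1}(z_1)⋯dm_{s_m}(z_m) ≤ C ‖f‖_{A_λ^p}^p for every f ∈ A_λ^p(ℝ^{n+1}_+). -/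

import Mathlib

open MeasureTheory Real Set
open scoped ENNReal

noncomputable section

abbrev Euc (N : ℕ) : Type := EuclideanSpace ℝ (Fin N)

/-- The point `(x, t) ∈ ℝ^{n+1}`. -/
def pt {n : ℕ} (x : Euc n) (t : ℝ) : Euc (n + 1) :=
  (EuclideanSpace.equiv (Fin (n + 1)) ℝ).symm (Fin.snoc (fun i => x i) t)

/-- horizontal part of a point of ℝ^{n+1} -/
def xp {n : ℕ} (z : Euc (n + 1)) : Euc n :=
  (EuclideanSpace.equiv (Fin n) ℝ).symm (fun i => z i.castSucc)

/-- vertical part of a point of ℝ^{n+1} -/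
def tp {n : ℕ} (z : Euc (n + 1)) : ℝ := z (Fin.last n)

/-- The upper half space ℝ^{n+1}_+. -/
def upperHS (n : ℕ) : Set (Euc (n + 1)) := {z | 0 < tp z}

/-- |z - w̄| where z = (x,t), w̄ = (y, -s): Euclidean distance -/
def dB {n : ℕ} (x : Euc n) (t : ℝ) (y : Euc n) (s : ℝ) : ℝ :=
  dist (pt x t) (pt y (-s))

/-- the measure t^λ dx dt on ℝ^n × (0,∞), identified with ℝ^{n+1}_+ -/
def mLam (n : ℕ) (l : ℝ) : Measure (Euc n × ℝ) :=
  ((volume : Measure (Euc n)).prod ((volume : Measure ℝ).restrict (Ioi 0))).withDensity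
    (fun zt => ENNReal.ofReal (zt.2 ^ l))

/-- second derivative of `f` at `z` along direction `v` -/
def d2 {V : Type*} [NormedAddCommGroup V] [NormedSpace ℝ V] (f : V → ℝ) (z v : V) : ℝ :=
  iteratedFDeriv ℝ 2 f z ![v, v]

/-- `f` is harmonic on a subset of ℝ^N : twice continuously differentiable with
vanishing Laplacian. -/
def HarmonicOnE {N : ℕ} (f : Euc N → ℝ) (s : Set (Euc N)) : Prop :=
  ContDiffOn ℝ 2 f s ∧ ∀ z ∈ s, ∑ i, d2 f z (EuclideanSpace.single i 1) = 0

/-- `f` is harmonic on (ℝ^{n+1}_+)^m, viewed as an open subset of ℝ^{m(n+1)}. -/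
def HarmonicOnM {n m : ℕ} (f : (Fin m → Euc (n + 1)) → ℝ) : Prop :=
  ContDiffOn ℝ 2 f {z | ∀ j, z j ∈ upperHS n} ∧
  ∀ z ∈ {z : Fin m → Euc (n + 1) | ∀ j, z j ∈ upperHS n},
    ∑ j, ∑ i, d2 f z (Function.update (0 : Fin m → Euc (n + 1)) j (EuclideanSpace.single i 1)) = 0

/-- `f` is harmonic in each variable separately on (ℝ^{n+1}_+)^m -/
def HarmonicSep {n m : ℕ} (f : (Fin m → Euc (n + 1)) → ℝ) : Prop :=
  ∀ (j : Fin m) (z : Fin m → Euc (n + 1)), (∀ k, z k ∈ upperHS n) →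
    HarmonicOnE (fun w => f (Function.update z j w)) (upperHS n)

/-- the closed cube centered at (y,s) with side length s -/
def Qcube {n : ℕ} (y : Euc n) (s : ℝ) : Set (Euc (n + 1)) :=
  {z | (∀ i : Fin n, |z (Fin.castSucc i) - y i| ≤ s / 2) ∧ |tp z - s| ≤ s / 2}

/-- the A^p_λ (quasi)-norm, raised to the power p -/
def normAp (n : ℕ) (f : Euc (n + 1) → ℝ) (p l : ℝ) : ℝ≥0∞ :=
  ∫⁻ zt : Euc n × ℝ, ENNReal.ofReal (|f (pt zt.1 zt.2)| ^ p) ∂(mLam n l)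

/-- membership in the harmonic Bergman space A^p_λ -/
def memAp (n : ℕ) (f : Euc (n + 1) → ℝ) (p l : ℝ) : Prop :=
  HarmonicOnE f (upperHS n) ∧ normAp n f p l < ⊤

/-- Lebesgue measure dy ds on ℝ^n × (0,∞) -/
def baseM (n : ℕ) : Measure (Euc n × ℝ) :=
  (volume : Measure (Euc n)).prod ((volume : Measure ℝ).restrict (Ioi 0))

/-- the integral operator S_{a,b} -/
def Sab (n m : ℕ) (a b : Fin m → ℝ) (f : Euc (n + 1) → ℝ) (z : Fin m → Euc n × ℝ) : ℝ :=
  (∏ j, (z j).2 ^ a j) *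
    ∫ w : Euc n × ℝ, f (pt w.1 w.2) * w.2 ^ (-(n : ℝ) - 1 + ∑ j, b j) /
      ∏ j, (dB (z j).1 (z j).2 w.1 w.2) ^ (a j + b j) ∂(baseM n)

/-- The truncated paraboloid `max 0 (1 - ‖u‖²)`. -/
def paraboloid {N : ℕ} (u : Euc N) : ℝ := max 0 (1 - ‖u‖ ^ 2)

/-- A compactly supported radial function with gradient `paraboloid u • u`. -/
def paraboloidPot {N : ℕ} (u : Euc N) : ℝ := (1 / 2) * ∫ x in (1 : ℝ)..‖u‖ ^ 2, max 0 (1 - x)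

lemma continuous_paraboloid {N : ℕ} : Continuous (paraboloid (N := N)) := by
  unfold paraboloid; fun_prop

lemma paraboloid_nonneg {N : ℕ} (u : Euc N) : 0 ≤ paraboloid u := le_max_left _ _

lemma paraboloid_le_one {N : ℕ} (u : Euc N) : paraboloid u ≤ 1 :=
  max_le zero_le_one (by nlinarith [sq_nonneg ‖u‖])

lemma paraboloid_eq_zero {N : ℕ} {u : Euc N} (h : 1 ≤ ‖u‖) : paraboloid u = 0 :=
  max_eq_left (by nlinarith)

lemma paraboloidPot_eq_zero {N : ℕ} {u : Euc N} (h : 1 ≤ ‖u‖) : paraboloidPot u = 0 := by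
  have h1 : (1 : ℝ) ≤ ‖u‖ ^ 2 := by nlinarith
  have : ∫ x in (1 : ℝ)..‖u‖ ^ 2, max 0 (1 - x) = ∫ x in (1 : ℝ)..‖u‖ ^ 2, (0 : ℝ) := by
    apply intervalIntegral.integral_congr
    intro x hx
    rw [uIcc_of_le h1] at hx
    exact max_eq_left (by linarith [hx.1])
  simp [paraboloidPot, this]

lemma hasCompactSupport_of_one_le_norm {N : ℕ} {h : Euc N → ℝ}
    (hh : ∀ u, 1 ≤ ‖u‖ → h u = 0) : HasCompactSupport h := by
  refine HasCompactSupport.intro (isCompact_closedBall (0 : Euc N) 1) fun u hu => hh u ?_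
  simp only [Metric.mem_closedBall, dist_zero_right, not_le] at hu
  exact hu.le

lemma hasCompactSupport_paraboloid {N : ℕ} : HasCompactSupport (paraboloid (N := N)) :=
  hasCompactSupport_of_one_le_norm fun _ => paraboloid_eq_zero

lemma hasCompactSupport_paraboloidPot {N : ℕ} : HasCompactSupport (paraboloidPot (N := N)) :=
  hasCompactSupport_of_one_le_norm fun _ => paraboloidPot_eq_zero

lemma hasFDerivAt_paraboloidPot {N : ℕ} (u : Euc N) :
    HasFDerivAt (paraboloidPot (N := N)) (paraboloid u • innerSL ℝ u) u := by
  have hc : Continuous fun x : ℝ => max 0 (1 - x) := by fun_prop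
  have h1 : HasDerivAt (fun t : ℝ => ∫ x in (1 : ℝ)..t, max 0 (1 - x))
      (max 0 (1 - ‖u‖ ^ 2)) (‖u‖ ^ 2) :=
    intervalIntegral.integral_hasDerivAt_right (hc.intervalIntegrable _ _)
      hc.stronglyMeasurable.stronglyMeasurableAtFilter hc.continuousAt
  have h2 := (h1.comp_hasFDerivAt u (hasStrictFDerivAt_norm_sq u).hasFDerivAt).const_mul (1 / 2)
  refine h2.congr_fderiv ?_
  ext v
  simp [paraboloid]
  ring

lemma integral_paraboloid_pos (N : ℕ) : 0 < ∫ u : Euc N, paraboloid u :=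
  continuous_paraboloid.integral_pos_of_hasCompactSupport_nonneg_nonzero
    hasCompactSupport_paraboloid paraboloid_nonneg (x := 0) (by simp [paraboloid])

lemma integral_fderiv_mul_paraboloid_eq_zero {N : ℕ} {g : Euc N → ℝ} (hg : ContDiff ℝ 2 g)
    (w : Euc N) {r : ℝ} (hr : 0 ≤ r)
    (harm : ∀ v ∈ Metric.ball w r, ∑ i, d2 g v (EuclideanSpace.single i 1) = 0) :
    ∫ u : Euc N, fderiv ℝ g (w + r • u) u * paraboloid u = 0 := by
  have hg1 : ContDiff ℝ 1 (fderiv ℝ g) := hg.fderiv_right (by norm_num)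
  set e : Fin N → Euc N := fun i => EuclideanSpace.single i 1 with he
  have hd : ∀ i u, HasFDerivAt (fun u => fderiv ℝ g (w + r • u) (e i))
      ((r • (fderiv ℝ (fderiv ℝ g) (w + r • u)).flip (e i))) u := by
    intro i u
    have h1 : HasFDerivAt (fun u : Euc N => w + r • u) (r • ContinuousLinearMap.id ℝ (Euc N)) u :=
      ((hasFDerivAt_id u).const_smul r).const_add w
    have h2 := ((hg1.differentiable (by norm_num)) (w + r • u)).hasFDerivAt.comp u h1
    have h3 := h2.clm_apply (hasFDerivAt_const (e i) u)
    refine h3.congr_fderiv ?_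
    ext v
    simp
  have hcont2 : Continuous (fderiv ℝ (fderiv ℝ g)) := hg1.continuous_fderiv (by norm_num)
  have hcont1 : Continuous (fderiv ℝ g) := hg1.continuous
  have hpot : Differentiable ℝ (paraboloidPot (N := N)) :=
    fun u => (hasFDerivAt_paraboloidPot u).differentiableAt
  have hfd : ∀ i u, fderiv ℝ (fun u => fderiv ℝ g (w + r • u) (e i)) u (e i)
      = r * d2 g (w + r • u) (e i) := by
    intro i u
    rw [(hd i u).fderiv, d2, iteratedFDeriv_two_apply]
    simp
  have hpd : ∀ i u, fderiv ℝ (paraboloidPot (N := N)) u (e i) = paraboloid u * u i := by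
    intro i u
    rw [(hasFDerivAt_paraboloidPot u).fderiv]
    simp [he, EuclideanSpace.inner_single_right]
  have hd2c : ∀ i, Continuous fun u => d2 g (w + r • u) (e i) := by
    intro i
    simp only [d2, iteratedFDeriv_two_apply]
    fun_prop
  have hi1 : ∀ i, Integrable fun u => r * d2 g (w + r • u) (e i) * paraboloidPot u := fun i =>
    Continuous.integrable_of_hasCompactSupport
      ((continuous_const.mul (hd2c i)).mul hpot.continuous)
      hasCompactSupport_paraboloidPot.mul_left
  have hi2 : ∀ i, Integrable fun u => fderiv ℝ g (w + r • u) (e i) * (paraboloid u * u i) :=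
    fun i => Continuous.integrable_of_hasCompactSupport
      (by have := continuous_paraboloid (N := N); fun_prop)
      (hasCompactSupport_paraboloid.mul_right.mul_left)
  have hi3 : ∀ i, Integrable fun u => fderiv ℝ g (w + r • u) (e i) * paraboloidPot u := fun i =>
    Continuous.integrable_of_hasCompactSupport
      (by have := hpot.continuous; fun_prop) hasCompactSupport_paraboloidPot.mul_left
  have hparts : ∀ i, ∫ u, fderiv ℝ g (w + r • u) (e i) * (paraboloid u * u i)
      = - ∫ u, r * d2 g (w + r • u) (e i) * paraboloidPot u := by
    intro i
    have := integral_mul_fderiv_eq_neg_fderiv_mul_of_integrable (μ := (volume : Measure (Euc N)))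
      (f := fun u => fderiv ℝ g (w + r • u) (e i)) (g := paraboloidPot) (v := e i)
      (by simpa only [hfd] using hi1 i) (by simpa only [hpd] using hi2 i) (hi3 i)
      (fun u _ => (hd i u).differentiableAt) (fun u _ => hpot u)
    simpa only [hfd, hpd] using this
  have hsum : ∀ u : Euc N, fderiv ℝ g (w + r • u) u * paraboloid u
      = ∑ i, fderiv ℝ g (w + r • u) (e i) * (paraboloid u * u i) := by
    intro u
    have hu : u = ∑ i, u i • e i := by
      ext j
      simp [he, Finset.sum_apply, Pi.single_apply]
    conv_lhs => rw [show fderiv ℝ g (w + r • u) u = fderiv ℝ g (w + r • u) (∑ i, u i • e i) by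
      rw [← hu]]
    rw [map_sum, Finset.sum_mul]
    refine Finset.sum_congr rfl fun i _ => ?_
    rw [map_smul, smul_eq_mul]; ring
  simp only [hsum]
  rw [integral_finsetSum _ fun i _ => hi2 i]
  simp only [hparts]
  rw [Finset.sum_neg_distrib, ← integral_finsetSum _ fun i _ => hi1 i, neg_eq_zero]
  refine integral_eq_zero_of_ae (Filter.Eventually.of_forall fun u => ?_)
  simp only [Pi.zero_apply, ← Finset.sum_mul, ← Finset.mul_sum]
  rcases le_or_gt 1 ‖u‖ with h | h
  · rw [paraboloidPot_eq_zero h, mul_zero]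
  · rcases hr.eq_or_lt with rfl | hr
    · simp
    · rw [harm _ ?_]
      · simp
      · simp only [Metric.mem_ball, dist_self_add_left, norm_smul, Real.norm_eq_abs, abs_of_pos hr]
        nlinarith

lemma integral_mul_paraboloid_eq {N : ℕ} {g : Euc N → ℝ} (hg : ContDiff ℝ 2 g)
    (hgc : HasCompactSupport g) (w : Euc N) {R : ℝ} (hR : 0 ≤ R)
    (harm : ∀ v ∈ Metric.ball w R, ∑ i, d2 g v (EuclideanSpace.single i 1) = 0) :
    ∫ u : Euc N, g (w + R • u) * paraboloid u = g w * ∫ u : Euc N, paraboloid u := by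
  have hg1 : Continuous (fderiv ℝ g) := hg.continuous_fderiv (by norm_num)
  have hpc := continuous_paraboloid (N := N)
  obtain ⟨L, hL⟩ := hg1.bounded_above_of_compact_support (hgc.fderiv ℝ)
  have hder : ∀ r : ℝ, HasDerivAt (fun r : ℝ => ∫ u : Euc N, g (w + r • u) * paraboloid u)
      (∫ u : Euc N, fderiv ℝ g (w + r • u) u * paraboloid u) r := by
    intro r
    have hgc' := hg.continuous
    refine (hasDerivAt_integral_of_dominated_loc_of_deriv_le (s := Set.univ) Filter.univ_mem
      (F := fun (r : ℝ) (u : Euc N) => g (w + r • u) * paraboloid u)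
      (F' := fun (r : ℝ) (u : Euc N) => fderiv ℝ g (w + r • u) u * paraboloid u)
      (bound := fun u => L * ‖u‖ * paraboloid u) ?_ ?_ ?_ ?_ ?_ ?_).2
    · exact Filter.Eventually.of_forall fun x =>
        Continuous.aestronglyMeasurable (by fun_prop)
    · exact Continuous.integrable_of_hasCompactSupport (by fun_prop)
        hasCompactSupport_paraboloid.mul_left
    · exact Continuous.aestronglyMeasurable (by fun_prop)
    · refine Filter.Eventually.of_forall fun u x _ => ?_
      rw [norm_mul, Real.norm_of_nonneg (paraboloid_nonneg u)]
      refine mul_le_mul_of_nonneg_right ?_ (paraboloid_nonneg u)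
      refine ((fderiv ℝ g (w + x • u)).le_opNorm u).trans ?_
      exact mul_le_mul_of_nonneg_right (hL _) (norm_nonneg u)
    · exact Continuous.integrable_of_hasCompactSupport (by fun_prop)
        hasCompactSupport_paraboloid.mul_left
    · refine Filter.Eventually.of_forall fun u x _ => HasDerivAt.mul_const ?_ _
      have h1 : HasDerivAt (fun x : ℝ => w + x • u) u x := by
        simpa using ((hasDerivAt_id x).smul_const u).const_add (c := w)
      exact ((hg.differentiable (by norm_num)) (w + x • u)).hasFDerivAt.comp_hasDerivAt x h1
  have hconst := constant_of_has_deriv_right_zero (a := 0) (b := R)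
    (f := fun r : ℝ => ∫ u : Euc N, g (w + r • u) * paraboloid u)
    (fun r _ => (hder r).continuousAt.continuousWithinAt)
    (fun r hr => by
      have := hder r
      rw [integral_fderiv_mul_paraboloid_eq_zero hg w hr.1
        fun v hv => harm v (Metric.ball_subset_ball hr.2.le hv)] at this
      exact this.hasDerivWithinAt) R ⟨hR, le_rfl⟩
  simp only [zero_smul, add_zero] at hconst
  rw [hconst, integral_const_mul]

lemma exists_forall_abs_mul_pow_le_integral (N : ℕ) :
    ∃ C : ℝ, 0 < C ∧ ∀ (f : Euc N → ℝ) (w : Euc N) (R ρ : ℝ), 0 < R → R < ρ →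
      HarmonicOnE f (Metric.ball w ρ) →
      |f w| * R ^ N ≤ C * ∫ v in Metric.closedBall w R, |f v| := by
  set c := ∫ u : Euc N, paraboloid u with hc
  have hc0 : 0 < c := integral_paraboloid_pos N
  refine ⟨c⁻¹, inv_pos.2 hc0, fun f w R ρ hR hρ hf => ?_⟩
  let b : ContDiffBump w := ⟨(2 * R + ρ) / 3, (R + 2 * ρ) / 3, by linarith, by linarith⟩
  have hbIn : b.rIn = (2 * R + ρ) / 3 := rfl
  have hbOut : b.rOut = (R + 2 * ρ) / 3 := rfl
  set g : Euc N → ℝ := fun v => b v * f v with hgdef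
  have hsub : Metric.closedBall w R ⊆ Metric.ball w ρ := Metric.closedBall_subset_ball hρ
  have hg : ContDiff ℝ 2 g := by
    rw [contDiff_iff_contDiffAt]
    intro v
    by_cases hv : v ∈ Metric.ball w ρ
    · exact b.contDiff.contDiffAt.mul (hf.1.contDiffAt (Metric.isOpen_ball.mem_nhds hv))
    · have hv' : v ∉ tsupport b := by
        rw [b.tsupport_eq]
        simp only [Metric.mem_ball, Metric.mem_closedBall, not_lt, not_le] at hv ⊢
        linarith
      have h0 : g =ᶠ[nhds v] fun _ => 0 := by
        filter_upwards [(isClosed_tsupport b).isOpen_compl.mem_nhds hv'] with x hx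
        simp [hgdef, image_eq_zero_of_notMem_tsupport hx]
      exact contDiffAt_const.congr_of_eventuallyEq h0
  have hgc : HasCompactSupport g := b.hasCompactSupport.mul_right
  have hgf : ∀ v ∈ Metric.closedBall w R, g =ᶠ[nhds v] f := by
    intro v hv
    have hv' : v ∈ Metric.ball w b.rIn := by
      simp only [Metric.mem_closedBall, Metric.mem_ball] at hv ⊢
      linarith
    filter_upwards [Metric.isOpen_ball.mem_nhds hv'] with x hx
    simp [hgdef, b.one_of_mem_closedBall (Metric.ball_subset_closedBall hx)]
  have hkey := integral_mul_paraboloid_eq hg hgc w hR.le fun v hv => by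
    have hv' := Metric.ball_subset_closedBall hv
    rw [← hf.2 v (hsub hv')]
    simp only [d2, ((hgf v hv').iteratedFDeriv ℝ 2).self_of_nhds]
  rw [(hgf w (Metric.mem_closedBall_self hR.le)).self_of_nhds, ← hc] at hkey
  set h : Euc N → ℝ := (Metric.closedBall w R).indicator fun v => |f v| with hh
  have hfint : IntegrableOn (fun v => |f v|) (Metric.closedBall w R) :=
    (hf.1.continuousOn.mono hsub).abs.integrableOn_compact (isCompact_closedBall w R)
  have hhfint : Integrable h := hfint.integrable_indicator measurableSet_closedBall
  have hle : ‖∫ u : Euc N, g (w + R • u) * paraboloid u‖ ≤ ∫ u : Euc N, h (w + R • u) := by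
    refine norm_integral_le_of_norm_le ((hhfint.comp_add_left w).comp_smul hR.ne')
      (Filter.Eventually.of_forall fun u => ?_)
    rw [norm_mul, Real.norm_of_nonneg (paraboloid_nonneg u)]
    rcases le_or_gt 1 ‖u‖ with hu | hu
    · rw [paraboloid_eq_zero hu, mul_zero]
      exact Set.indicator_nonneg (fun _ _ => abs_nonneg _) _
    · have hmem : w + R • u ∈ Metric.closedBall w R := by
        simp only [Metric.mem_closedBall, dist_self_add_left, norm_smul, Real.norm_eq_abs,
          abs_of_pos hR]
        nlinarith
      rw [hh, Set.indicator_of_mem hmem, (hgf _ hmem).self_of_nhds, Real.norm_eq_abs]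
      exact mul_le_of_le_one_right (abs_nonneg _) (paraboloid_le_one u)
  rw [hkey, Measure.integral_comp_smul volume (fun u => h (w + u)) R,
    integral_add_left_eq_self h w, hh, integral_indicator measurableSet_closedBall,
    finrank_euclideanSpace_fin, Real.norm_eq_abs, abs_mul, abs_of_pos hc0, smul_eq_mul,
    abs_of_pos (show 0 < (R ^ N)⁻¹ by positivity)] at hle
  have hRN : 0 < R ^ N := by positivity
  rw [inv_mul_eq_div, le_div_iff₀' hRN] at hle
  rw [inv_mul_eq_div, le_div_iff₀ hc0]
  linarith

lemma exists_forall_abs_rpow_mul_pow_le_integral {N : ℕ} (hN : N ≠ 0) {p : ℝ} (hp0 : 0 < p)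
    (hp1 : p ≤ 1) :
    ∃ C : ℝ, 0 < C ∧ ∀ (f : Euc N → ℝ) (w : Euc N) (R ρ : ℝ), 0 < R → R < ρ →
      HarmonicOnE f (Metric.ball w ρ) →
      |f w| ^ p * R ^ N ≤ C * ∫ v in Metric.closedBall w R, |f v| ^ p := by
  obtain ⟨C, hC, hmain⟩ := exists_forall_abs_mul_pow_le_integral N
  set q : ℝ := N / p with hq
  have hq0 : 0 < q := by positivity
  have hqp : q * p = N := by rw [hq]; field_simp
  refine ⟨2 ^ q * C, by positivity, fun f w R ρ hR hρ hf => ?_⟩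
  have hsub : Metric.closedBall w R ⊆ Metric.ball w ρ := Metric.closedBall_subset_ball hρ
  have hfc : ContinuousOn f (Metric.closedBall w R) := hf.1.continuousOn.mono hsub
  have hfpc : ContinuousOn (fun v => |f v| ^ p) (Metric.closedBall w R) :=
    hfc.abs.rpow_const fun _ _ => Or.inr hp0.le
  have hfint : IntegrableOn (fun v => |f v| ^ p) (Metric.closedBall w R) :=
    hfpc.integrableOn_compact (isCompact_closedBall w R)
  set I := ∫ v in Metric.closedBall w R, |f v| ^ p with hI
  have hI0 : 0 ≤ I := integral_nonneg fun _ => by positivity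
  obtain ⟨v₀, hv₀, hmax⟩ := (isCompact_closedBall w R).exists_isMaxOn
    ⟨w, Metric.mem_closedBall_self hR.le⟩
    (f := fun v => |f v| * (R - dist v w) ^ q)
    (hfc.abs.mul (ContinuousOn.rpow_const (by fun_prop) fun _ _ => Or.inr hq0.le))
  set M := |f v₀| * (R - dist v₀ w) ^ q with hM
  have hmax' : ∀ v ∈ Metric.closedBall w R, |f v| * (R - dist v w) ^ q ≤ M := fun v hv => hmax hv
  have hd0 : 0 ≤ R - dist v₀ w := by linarith [Metric.mem_closedBall.1 hv₀]
  have hM0 : 0 ≤ M := by positivity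
  have hw : |f w| ^ p * R ^ N ≤ M ^ p := by
    have h1 := hmax' w (Metric.mem_closedBall_self hR.le)
    rw [dist_self, sub_zero] at h1
    have h2 := Real.rpow_le_rpow (by positivity) h1 hp0.le
    rwa [Real.mul_rpow (abs_nonneg _) (by positivity), ← Real.rpow_mul hR.le, hqp,
      Real.rpow_natCast] at h2
  refine hw.trans ?_
  rcases hM0.eq_or_lt with hM0' | hMpos
  · rw [← hM0', Real.zero_rpow hp0.ne']
    positivity
  have hdpos : 0 < R - dist v₀ w := by
    refine hd0.lt_of_ne fun h => ?_
    rw [hM, ← h, Real.zero_rpow hq0.ne', mul_zero] at hMpos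
    exact lt_irrefl _ hMpos
  set δ := (R - dist v₀ w) / 2 with hδ
  have hδ0 : 0 < δ := by positivity
  have hdδ : R - dist v₀ w = 2 * δ := by rw [hδ]; ring
  have hbsub : Metric.closedBall v₀ δ ⊆ Metric.closedBall w R := fun v hv => by
    simp only [Metric.mem_closedBall] at hv ⊢
    linarith [dist_triangle v v₀ w]
  have hloc := hmain f v₀ δ (2 * δ) hδ0 (by linarith) (by
    have : Metric.ball v₀ (2 * δ) ⊆ Metric.ball w ρ := fun v hv => by
      simp only [Metric.mem_ball] at hv ⊢
      linarith [dist_triangle v v₀ w]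
    exact ⟨hf.1.mono this, fun v hv => hf.2 v (this hv)⟩)
  have hpt : ∀ v ∈ Metric.closedBall v₀ δ,
      |f v| ≤ |f v| ^ p * (M * δ ^ (-q)) ^ (1 - p) := by
    intro v hv
    have hdv : δ ≤ R - dist v w := by
      linarith [dist_triangle v v₀ w, Metric.mem_closedBall.1 hv]
    have h1 : |f v| ≤ M * δ ^ (-q) := by
      rw [Real.rpow_neg hδ0.le, ← div_eq_mul_inv, le_div_iff₀ (by positivity)]
      refine le_trans ?_ (hmax' v (hbsub hv))
      gcongr
    calc |f v| = |f v| ^ p * |f v| ^ (1 - p) := by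
          rw [← Real.rpow_add_of_nonneg (abs_nonneg _) hp0.le (by linarith)]; simp
      _ ≤ _ := by
          gcongr
  have hIle : ∫ v in Metric.closedBall v₀ δ, |f v| ≤ I * (M * δ ^ (-q)) ^ (1 - p) := by
    calc ∫ v in Metric.closedBall v₀ δ, |f v|
        ≤ ∫ v in Metric.closedBall v₀ δ, |f v| ^ p * (M * δ ^ (-q)) ^ (1 - p) := by
          refine setIntegral_mono_on ?_ ((hfint.mono_set hbsub).mul_const _)
            measurableSet_closedBall hpt
          exact (hfc.mono hbsub).abs.integrableOn_compact (isCompact_closedBall _ _)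
      _ = (∫ v in Metric.closedBall v₀ δ, |f v| ^ p) * (M * δ ^ (-q)) ^ (1 - p) :=
          integral_mul_const _ _
      _ ≤ _ := by
          refine mul_le_mul_of_nonneg_right ?_ (by positivity)
          exact setIntegral_mono_set hfint
            (Filter.Eventually.of_forall fun _ => by positivity) hbsub.eventuallyLE
  have hfin : M ≤ 2 ^ q * C * I * M ^ (1 - p) := by
    have h1 : |f v₀| * δ ^ N ≤ C * (I * (M * δ ^ (-q)) ^ (1 - p)) :=
      hloc.trans (by gcongr)
    rw [Real.mul_rpow hMpos.le (by positivity), ← Real.rpow_mul hδ0.le] at h1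
    have h2 : -q * (1 - p) = N - q := by linarith
    rw [h2, Real.rpow_sub hδ0, Real.rpow_natCast] at h1
    have hδN : 0 < δ ^ N := by positivity
    have hδq : 0 < δ ^ q := by positivity
    have h3 : |f v₀| ≤ C * (I * M ^ (1 - p)) / δ ^ q := by
      rw [le_div_iff₀ hδq]
      refine le_of_mul_le_mul_right ?_ hδN
      calc |f v₀| * δ ^ q * δ ^ N = (|f v₀| * δ ^ N) * δ ^ q := by ring
        _ ≤ (C * (I * (M ^ (1 - p) * (δ ^ N / δ ^ q)))) * δ ^ q := by gcongr
        _ = _ := by field_simp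
    rw [le_div_iff₀ hδq] at h3
    calc M = 2 ^ q * (|f v₀| * δ ^ q) := by
          rw [hM, hdδ, Real.mul_rpow zero_le_two hδ0.le]; ring
      _ ≤ 2 ^ q * (C * (I * M ^ (1 - p))) := by gcongr
      _ = _ := by ring
  have hMp : 0 < M ^ (1 - p) := by positivity
  refine le_of_mul_le_mul_right ?_ hMp
  rw [← Real.rpow_add hMpos]
  simpa using hfin

lemma rpow_lintegral_mul_le {α : Type*} [MeasurableSpace α] {μ : Measure α} {F W : α → ℝ≥0∞}
    {p : ℝ} (hp0 : 0 < p) (hp1 : p ≤ 1) {D : ℝ≥0∞} (hD0 : D ≠ 0) (hD : D ≠ ⊤)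
    (h : ∀ᵐ x ∂μ, F x ^ p ≤ D * ∫⁻ y, F y ^ p * W y ∂μ) :
    (∫⁻ x, F x * W x ∂μ) ^ p ≤ D ^ (1 - p) * ∫⁻ x, F x ^ p * W x ∂μ := by
  set I := ∫⁻ x, F x ^ p * W x ∂μ with hI
  have hp1' : 0 ≤ 1 - p := by linarith
  rcases eq_or_ne I ⊤ with hIt | hIt
  · rw [hIt, ENNReal.mul_top (ENNReal.rpow_pos (pos_iff_ne_zero.2 hD0) hD).ne']
    exact le_top
  have hr : 0 ≤ (1 - p) / p := div_nonneg hp1' hp0.le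
  have hJ : ∫⁻ x, F x * W x ∂μ ≤ (D * I) ^ ((1 - p) / p) * I := by
    rw [hI, ← lintegral_const_mul' _ _
      (ENNReal.rpow_ne_top_of_nonneg hr (ENNReal.mul_ne_top hD hIt))]
    refine lintegral_mono_ae ?_
    filter_upwards [h] with x hx
    have h1 : F x = F x ^ p * F x ^ (1 - p) := by
      rw [← ENNReal.rpow_add_of_nonneg _ _ hp0.le hp1']; simp
    have h2 : F x ^ (1 - p) ≤ (D * I) ^ ((1 - p) / p) := by
      calc F x ^ (1 - p) = (F x ^ p) ^ ((1 - p) / p) := by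
            rw [← ENNReal.rpow_mul]; congr 1; field_simp
        _ ≤ _ := ENNReal.rpow_le_rpow hx hr
    calc F x * W x = F x ^ (1 - p) * (F x ^ p * W x) := by
          conv_lhs => rw [h1]
          ring
      _ ≤ _ := mul_le_mul_left h2 _
  calc (∫⁻ x, F x * W x ∂μ) ^ p ≤ ((D * I) ^ ((1 - p) / p) * I) ^ p :=
        ENNReal.rpow_le_rpow hJ hp0.le
    _ = D ^ (1 - p) * (I ^ (1 - p) * I ^ p) := by
        rw [ENNReal.mul_rpow_of_nonneg _ _ hp0.le, ← ENNReal.rpow_mul,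
          div_mul_cancel₀ _ hp0.ne', ENNReal.mul_rpow_of_nonneg _ _ hp1', mul_assoc]
    _ = D ^ (1 - p) * I := by
        rw [← ENNReal.rpow_add_of_nonneg _ _ hp1' hp0.le]; simp

lemma abs_tp_sub_tp_le_dist {n : ℕ} (v w : Euc (n + 1)) : |tp v - tp w| ≤ dist v w := by
  rw [dist_eq_norm]
  exact PiLp.norm_apply_le (v - w) (Fin.last n)

lemma measurableSet_upperHS (n : ℕ) : MeasurableSet (upperHS n) :=
  measurableSet_lt measurable_const (by unfold tp; fun_prop)

lemma exists_ofReal_rpow_le_lintegral_upperHS (n : ℕ) {p : ℝ} (hp0 : 0 < p) (hp1 : p ≤ 1)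
    {A : ℝ} (hA : 0 < A) :
    ∃ D : ℝ, 0 < D ∧ ∀ f H : Euc (n + 1) → ℝ, HarmonicOnE f (upperHS n) →
      (∀ w ∈ upperHS n, 0 ≤ H w) →
      (∀ w ∈ upperHS n, ∀ v, dist v w ≤ tp w / 2 → H w ≤ A * H v) →
      ∀ w ∈ upperHS n, ENNReal.ofReal (|f w| * H w) ^ p ≤
        ENNReal.ofReal D * ∫⁻ v in upperHS n,
          ENNReal.ofReal (|f v| * H v) ^ p * ENNReal.ofReal (tp v ^ (-(n : ℝ) - 1)) := by
  obtain ⟨C, hC, hmain⟩ :=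
    exists_forall_abs_rpow_mul_pow_le_integral (N := n + 1) n.succ_ne_zero hp0 hp1
  refine ⟨C * (A ^ p * 3 ^ (n + 1)), by positivity, fun f H hf hH hHA w hw => ?_⟩
  have hs : 0 < tp w := hw
  set s := tp w with hsdef
  set B := Metric.closedBall w (s / 2) with hB
  have hball : Metric.ball w s ⊆ upperHS n := fun v hv => by
    have := (abs_tp_sub_tp_le_dist v w).trans_lt (Metric.mem_ball.1 hv)
    rw [abs_lt] at this
    change 0 < tp v
    linarith
  have hBsub : B ⊆ Metric.ball w s := Metric.closedBall_subset_ball (by linarith)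
  have h1 := hmain f w (s / 2) s (by positivity) (by linarith)
    ⟨hf.1.mono hball, fun v hv => hf.2 v (hball hv)⟩
  have hfint : IntegrableOn (fun v => |f v| ^ p) B :=
    ((hf.1.continuousOn.mono (hBsub.trans hball)).abs.rpow_const
      fun _ _ => Or.inr hp0.le).integrableOn_compact (isCompact_closedBall _ _)
  have h2 : ENNReal.ofReal (|f w| ^ p * (s / 2) ^ (n + 1)) ≤
      ENNReal.ofReal C * ∫⁻ v in B, ENNReal.ofReal (|f v| ^ p) := by
    rw [← ofReal_integral_eq_lintegral_ofReal hfint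
      (Filter.Eventually.of_forall fun _ => by positivity), ← ENNReal.ofReal_mul hC.le]
    exact ENNReal.ofReal_le_ofReal h1
  set κ := H w ^ p * ((s / 2) ^ (n + 1))⁻¹ with hκ
  have hκ0 : 0 ≤ κ := by have := hH w hw; positivity
  have hsn : 0 < (s / 2) ^ (n + 1) := by positivity
  calc ENNReal.ofReal (|f w| * H w) ^ p
      = ENNReal.ofReal κ * ENNReal.ofReal (|f w| ^ p * (s / 2) ^ (n + 1)) := by
        have := hH w hw
        rw [ENNReal.ofReal_rpow_of_nonneg (by positivity) hp0.le, ← ENNReal.ofReal_mul hκ0,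
          Real.mul_rpow (abs_nonneg _) this]
        congr 1
        rw [hκ]
        field_simp
    _ ≤ ENNReal.ofReal κ * (ENNReal.ofReal C * ∫⁻ v in B, ENNReal.ofReal (|f v| ^ p)) := by
        gcongr
    _ = ENNReal.ofReal C * ∫⁻ v in B, ENNReal.ofReal κ * ENNReal.ofReal (|f v| ^ p) := by
        rw [lintegral_const_mul' _ _ ENNReal.ofReal_ne_top]; ring
    _ ≤ ENNReal.ofReal C * ∫⁻ v in B, ENNReal.ofReal (A ^ p * 3 ^ (n + 1)) *
          (ENNReal.ofReal (|f v| * H v) ^ p * ENNReal.ofReal (tp v ^ (-(n : ℝ) - 1))) := by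
        gcongr ENNReal.ofReal C * ?_
        refine setLIntegral_mono' measurableSet_closedBall fun v hv => ?_
        have hvw : dist v w ≤ s / 2 := Metric.mem_closedBall.1 hv
        have hvt := abs_le.1 ((abs_tp_sub_tp_le_dist v w).trans hvw)
        have htv : 0 < tp v := by linarith
        have hHv := hH v htv
        have hHw := hH w hw
        rw [ENNReal.ofReal_rpow_of_nonneg (by positivity) hp0.le,
          ← ENNReal.ofReal_mul (by positivity), ← ENNReal.ofReal_mul (by positivity),
          ← ENNReal.ofReal_mul (by positivity)]
        refine ENNReal.ofReal_le_ofReal ?_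
        have e1 : tp v ^ (-(n : ℝ) - 1) = (tp v ^ (n + 1))⁻¹ := by
          rw [show -(n : ℝ) - 1 = -((n + 1 : ℕ) : ℝ) by push_cast; ring, Real.rpow_neg htv.le,
            Real.rpow_natCast]
        have e2 : ((s / 2) ^ (n + 1))⁻¹ ≤ 3 ^ (n + 1) * (tp v ^ (n + 1))⁻¹ := by
          rw [← div_eq_mul_inv, le_div_iff₀ (by positivity), inv_mul_le_iff₀ hsn, ← mul_pow]
          gcongr
          linarith
        have e3 : H w ^ p ≤ A ^ p * H v ^ p := by
          rw [← Real.mul_rpow hA.le hHv]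
          exact Real.rpow_le_rpow hHw (hHA w hw v hvw) hp0.le
        rw [e1, hκ, Real.mul_rpow (abs_nonneg _) hHv]
        calc H w ^ p * ((s / 2) ^ (n + 1))⁻¹ * |f v| ^ p
            ≤ (A ^ p * H v ^ p) * (3 ^ (n + 1) * (tp v ^ (n + 1))⁻¹) * |f v| ^ p := by gcongr
          _ = _ := by ring
    _ = ENNReal.ofReal (C * (A ^ p * 3 ^ (n + 1))) * ∫⁻ v in B,
          ENNReal.ofReal (|f v| * H v) ^ p * ENNReal.ofReal (tp v ^ (-(n : ℝ) - 1)) := by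
        rw [lintegral_const_mul' _ _ ENNReal.ofReal_ne_top, ENNReal.ofReal_mul hC.le, mul_assoc]
    _ ≤ _ := by
        gcongr
        exact hBsub.trans hball

@[simp] lemma tp_pt {n : ℕ} (x : Euc n) (t : ℝ) : tp (pt x t) = t := by
  simp [tp, pt]

@[simp] lemma xp_pt {n : ℕ} (x : Euc n) (t : ℝ) : xp (pt x t) = x := by
  ext i
  simp [xp, pt]

lemma pt_xp_tp {n : ℕ} (v : Euc (n + 1)) : pt (xp v) (tp v) = v := by
  ext i
  refine Fin.lastCases ?_ (fun j => ?_) i <;> simp [xp, tp, pt]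

lemma dist_pt_pt {n : ℕ} (x y : Euc n) (t s : ℝ) :
    dist (pt x t) (pt y s) = √(dist x y ^ 2 + (t - s) ^ 2) := by
  rw [EuclideanSpace.dist_eq, Fin.sum_univ_castSucc, EuclideanSpace.dist_eq,
    Real.sq_sqrt (Finset.sum_nonneg fun _ _ => sq_nonneg _)]
  simp [pt, Real.dist_eq]

lemma dB_eq {n : ℕ} (x y : Euc n) (t s : ℝ) : dB x t y s = √(dist x y ^ 2 + (t + s) ^ 2) := by
  rw [dB, dist_pt_pt, sub_neg_eq_add]

lemma continuous_pt {n : ℕ} : Continuous fun w : Euc n × ℝ => pt w.1 w.2 := by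
  unfold pt
  refine (EuclideanSpace.equiv (Fin (n + 1)) ℝ).symm.continuous.comp (continuous_pi fun i => ?_)
  refine Fin.lastCases ?_ (fun j => ?_) i
  · simpa using continuous_snd
  · simp only [Fin.snoc_castSucc]
    fun_prop

lemma measurableEmbedding_pt (n : ℕ) :
    MeasurableEmbedding fun w : Euc n × ℝ => pt w.1 w.2 :=
  continuous_pt.measurableEmbedding fun w v h =>
    Prod.ext (by simpa using congrArg xp h) (by simpa using congrArg tp h)

lemma measurePreserving_pt (n : ℕ) :
    MeasurePreserving (fun w : Euc n × ℝ => pt w.1 w.2) volume volume := by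
  have h1 : MeasurePreserving (fun w : ℝ × Euc n => (w.1, WithLp.ofLp w.2))
      (volume.prod volume) (volume.prod volume) :=
    (MeasurePreserving.id volume).prod (PiLp.volume_preserving_ofLp (Fin n))
  have h2 := (volume_preserving_piFinSuccAbove (fun _ : Fin (n + 1) => ℝ) (Fin.last n)).symm
  have h3 := ((PiLp.volume_preserving_toLp (Fin (n + 1))).comp h2).comp
    (h1.comp (Measure.measurePreserving_swap (μ := (volume : Measure (Euc n)))
      (ν := (volume : Measure ℝ))))
  have h4 : (fun w : Euc n × ℝ => pt w.1 w.2) =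
      (WithLp.toLp 2 ∘ ⇑(MeasurableEquiv.piFinSuccAbove (fun _ => ℝ) (Fin.last n)).symm) ∘
        (fun w : ℝ × Euc n => (w.1, w.2.ofLp)) ∘ Prod.swap := by
    ext w i
    refine Fin.lastCases ?_ (fun j => ?_) i <;> simp [pt, MeasurableEquiv.piFinSuccAbove]
  rw [h4]
  exact h3

lemma baseM_eq (n : ℕ) :
    baseM n = volume.restrict ((fun w : Euc n × ℝ => pt w.1 w.2) ⁻¹' upperHS n) := by
  have : (fun w : Euc n × ℝ => pt w.1 w.2) ⁻¹' upperHS n = univ ×ˢ Ioi 0 := by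
    ext w
    simp [upperHS]
  rw [this, Measure.volume_eq_prod, ← Measure.prod_restrict, Measure.restrict_univ, baseM]

lemma setLIntegral_upperHS (n : ℕ) (h : Euc (n + 1) → ℝ≥0∞) :
    ∫⁻ v in upperHS n, h v = ∫⁻ w, h (pt w.1 w.2) ∂baseM n := by
  rw [baseM_eq]
  exact ((measurePreserving_pt n).setLIntegral_comp_preimage_emb (measurableEmbedding_pt n) h
    (upperHS n)).symm

lemma ae_baseM_pos (n : ℕ) : ∀ᵐ w ∂baseM n, 0 < w.2 := by
  rw [baseM_eq]
  filter_upwards [ae_restrict_mem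
    ((measurableEmbedding_pt n).measurable (measurableSet_upperHS n))] with w hw
  simpa [upperHS] using hw

instance (n : ℕ) : SigmaFinite (baseM n) := by unfold baseM; infer_instance

instance (n : ℕ) (l : ℝ) : SigmaFinite (mLam n l) := by unfold mLam; infer_instance

lemma lintegral_mLam (n : ℕ) (l : ℝ) (h : Euc n × ℝ → ℝ≥0∞) :
    ∫⁻ z, h z ∂mLam n l = ∫⁻ z, ENNReal.ofReal (z.2 ^ l) * h z ∂baseM n :=
  lintegral_withDensity_eq_lintegral_mul_non_measurable _ (by fun_prop)
    (Filter.Eventually.of_forall fun _ => ENNReal.ofReal_lt_top) h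

lemma ae_mLam_pos (n : ℕ) (l : ℝ) : ∀ᵐ z ∂mLam n l, 0 < z.2 :=
  (withDensity_absolutelyContinuous _ _) (ae_baseM_pos n)

lemma dist_le_dB {n : ℕ} (x y : Euc n) (t s : ℝ) : dist x y ≤ dB x t y s := by
  rw [dB_eq]
  exact Real.le_sqrt_of_sq_le (by nlinarith [sq_nonneg (t + s)])

lemma add_le_dB {n : ℕ} (x y : Euc n) (t s : ℝ) : t + s ≤ dB x t y s := by
  rw [dB_eq]
  exact Real.le_sqrt_of_sq_le (by nlinarith [sq_nonneg (dist x y)])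

lemma dB_pos {n : ℕ} (x y : Euc n) {t s : ℝ} (ht : 0 < t) (hs : 0 < s) : 0 < dB x t y s :=
  (add_pos ht hs).trans_le (add_le_dB x y t s)

lemma measurable_dB (n : ℕ) :
    Measurable fun q : (Euc n × ℝ) × (Euc n × ℝ) => dB q.1.1 q.1.2 q.2.1 q.2.2 := by
  simp only [dB_eq]
  fun_prop

lemma lintegral_rpow_mul_add_rpow_le {α γ s : ℝ} (hα : -1 < α) (hγ : α + 1 < γ) (hs : 0 < s) :
    ∫⁻ t in Ioi (0 : ℝ), ENNReal.ofReal (t ^ α * (s + t) ^ (-γ)) ≤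
      ENNReal.ofReal ((1 / (α + 1) + 1 / (γ - α - 1)) * s ^ (α + 1 - γ)) := by
  have hα1 : 0 < α + 1 := by linarith
  have hγ1 : 0 < γ - α - 1 := by linarith
  have hγ0 : 0 < γ := by linarith
  have hI1 : IntegrableOn (fun t : ℝ => t ^ α * s ^ (-γ)) (Ioc 0 s) :=
    ((intervalIntegrable_iff_integrableOn_Ioc_of_le hs.le).1
      (intervalIntegral.intervalIntegrable_rpow' hα)).mul_const _
  have hI2 : IntegrableOn (fun t : ℝ => t ^ (α - γ)) (Ioi s) :=
    integrableOn_Ioi_rpow_of_lt (by linarith) hs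
  have h1 : ∫⁻ t in Ioc 0 s, ENNReal.ofReal (t ^ α * (s + t) ^ (-γ)) ≤
      ENNReal.ofReal (1 / (α + 1) * s ^ (α + 1 - γ)) := by
    calc ∫⁻ t in Ioc 0 s, ENNReal.ofReal (t ^ α * (s + t) ^ (-γ))
        ≤ ∫⁻ t in Ioc 0 s, ENNReal.ofReal (t ^ α * s ^ (-γ)) := by
          refine setLIntegral_mono' measurableSet_Ioc fun t ht => ENNReal.ofReal_le_ofReal ?_
          have : 0 ≤ t ^ α := Real.rpow_nonneg ht.1.le _
          exact mul_le_mul_of_nonneg_left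
            (Real.rpow_le_rpow_of_nonpos hs (by linarith [ht.1]) (by linarith)) this
      _ = ENNReal.ofReal (1 / (α + 1) * s ^ (α + 1 - γ)) := by
          rw [← ofReal_integral_eq_lintegral_ofReal hI1 ?_]
          · rw [integral_mul_const, ← intervalIntegral.integral_of_le hs.le,
              integral_rpow (Or.inl hα), Real.zero_rpow hα1.ne', sub_zero,
              sub_eq_add_neg (α + 1), Real.rpow_add hs (α + 1)]
            congr 1
            ring
          · filter_upwards [ae_restrict_mem measurableSet_Ioc] with t ht
            have : 0 ≤ t ^ α := Real.rpow_nonneg ht.1.le _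
            simp only [Pi.zero_apply]
            positivity
  have h2 : ∫⁻ t in Ioi s, ENNReal.ofReal (t ^ α * (s + t) ^ (-γ)) ≤
      ENNReal.ofReal (1 / (γ - α - 1) * s ^ (α + 1 - γ)) := by
    calc ∫⁻ t in Ioi s, ENNReal.ofReal (t ^ α * (s + t) ^ (-γ))
        ≤ ∫⁻ t in Ioi s, ENNReal.ofReal (t ^ (α - γ)) := by
          refine setLIntegral_mono' measurableSet_Ioi fun t ht => ENNReal.ofReal_le_ofReal ?_
          have ht0 : 0 < t := hs.trans ht
          rw [sub_eq_add_neg, Real.rpow_add ht0]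
          exact mul_le_mul_of_nonneg_left
            (Real.rpow_le_rpow_of_nonpos ht0 (by linarith) (by linarith)) (by positivity)
      _ = ENNReal.ofReal (1 / (γ - α - 1) * s ^ (α + 1 - γ)) := by
          rw [← ofReal_integral_eq_lintegral_ofReal hI2 ?_]
          · rw [integral_Ioi_rpow_of_lt (by linarith) hs,
              show α - γ + 1 = -(γ - α - 1) by ring, show α + 1 - γ = -(γ - α - 1) by ring,
              neg_div_neg_eq]
            congr 1
            ring
          · filter_upwards [ae_restrict_mem measurableSet_Ioi] with t ht
            exact Real.rpow_nonneg (hs.trans ht).le _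
  rw [← Ioc_union_Ioi_eq_Ioi hs.le, lintegral_union measurableSet_Ioi
    (Ioc_disjoint_Ioi le_rfl), add_mul, ENNReal.ofReal_add (by positivity) (by positivity)]
  exact add_le_add h1 h2

lemma lintegral_dist_add_rpow (n : ℕ) {γ : ℝ} (hγ : (n : ℝ) < γ) (y : Euc n) {s : ℝ}
    (hs : 0 < s) :
    ∫⁻ x : Euc n, ENNReal.ofReal ((s + dist x y) ^ (-γ)) =
      ENNReal.ofReal ((∫ x : Euc n, (1 + ‖x‖) ^ (-γ)) * s ^ ((n : ℝ) - γ)) := by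
  have hfint : Integrable fun x : Euc n => (1 + ‖x‖) ^ (-γ) :=
    integrable_one_add_norm (by simpa using hγ)
  have heq : (fun x : Euc n => (s + dist x y) ^ (-γ)) =
      fun x => s ^ (-γ) * (1 + ‖s⁻¹ • (x - y)‖) ^ (-γ) := by
    ext x
    rw [← Real.mul_rpow hs.le (by positivity), norm_smul, Real.norm_of_nonneg (by positivity),
      dist_eq_norm, mul_add, mul_inv_cancel_left₀ hs.ne', mul_one]
  have hint2 : Integrable fun x : Euc n => (s + dist x y) ^ (-γ) := by
    rw [heq]
    exact ((hfint.comp_smul (inv_ne_zero hs.ne')).comp_sub_right y).const_mul _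
  rw [← ofReal_integral_eq_lintegral_ofReal hint2
    (Filter.Eventually.of_forall fun x => by positivity), heq, integral_const_mul,
    integral_sub_right_eq_self (fun x : Euc n => (1 + ‖s⁻¹ • x‖) ^ (-γ)) y,
    Measure.integral_comp_inv_smul_of_nonneg volume (fun x : Euc n => (1 + ‖x‖) ^ (-γ)) hs.le,
    finrank_euclideanSpace_fin, smul_eq_mul, sub_eq_add_neg, Real.rpow_add hs, Real.rpow_natCast]
  congr 1
  ring

lemma exists_lintegral_rpow_div_dB_le (n : ℕ) {α γ : ℝ} (hα : -1 < α)
    (hγ : (n : ℝ) + 1 + α < γ) :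
    ∃ C : ℝ, 0 < C ∧ ∀ (y : Euc n) (s : ℝ), 0 < s →
      ∫⁻ z, ENNReal.ofReal (z.2 ^ α / dB z.1 z.2 y s ^ γ) ∂baseM n ≤
        ENNReal.ofReal (C * s ^ (α + n + 1 - γ)) := by
  set ε := (γ - n - 1 - α) / 2 with hε
  have hε0 : 0 < ε := by rw [hε]; linarith
  set γ₁ := (n : ℝ) + ε with hγ₁
  set γ₂ := 1 + α + ε with hγ₂
  have hsum : γ = γ₁ + γ₂ := by rw [hγ₁, hγ₂, hε]; ring
  have hγ₁0 : 0 < γ₁ := by positivity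
  have hγ₂0 : 0 < γ₂ := by linarith
  set K := ∫ x : Euc n, (1 + ‖x‖) ^ (-γ₁) with hK
  have hK0 : 0 ≤ K := integral_nonneg fun x => by positivity
  have hL0 : 0 < 1 / (α + 1) + 1 / (γ₂ - α - 1) :=
    add_pos (one_div_pos.2 (by linarith)) (one_div_pos.2 (by linarith))
  set L := 1 / (α + 1) + 1 / (γ₂ - α - 1) with hL
  refine ⟨2 ^ γ₁ * (K * L) + 1, by positivity, fun y s hs => ?_⟩
  calc ∫⁻ z, ENNReal.ofReal (z.2 ^ α / dB z.1 z.2 y s ^ γ) ∂baseM n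
      ≤ ∫⁻ z, ENNReal.ofReal (2 ^ γ₁) * (ENNReal.ofReal ((s + dist z.1 y) ^ (-γ₁)) *
          ENNReal.ofReal (z.2 ^ α * (s + z.2) ^ (-γ₂))) ∂baseM n := by
        refine lintegral_mono_ae ?_
        filter_upwards [ae_baseM_pos n] with z hz
        have hd := dB_pos z.1 y hz hs
        rw [← ENNReal.ofReal_mul (by positivity), ← ENNReal.ofReal_mul (by positivity)]
        refine ENNReal.ofReal_le_ofReal ?_
        have h1 : (dB z.1 z.2 y s) ^ (-γ₁) ≤ 2 ^ γ₁ * (s + dist z.1 y) ^ (-γ₁) := by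
          have h : (s + dist z.1 y) / 2 ≤ dB z.1 z.2 y s := by
            linarith [dist_le_dB z.1 y z.2 s, add_le_dB z.1 y z.2 s]
          refine (Real.rpow_le_rpow_of_nonpos (by positivity) h (by linarith)).trans_eq ?_
          rw [Real.div_rpow (by positivity) (by positivity), Real.rpow_neg zero_le_two, div_inv_eq_mul]
          ring
        have h2 : (dB z.1 z.2 y s) ^ (-γ₂) ≤ (s + z.2) ^ (-γ₂) :=
          Real.rpow_le_rpow_of_nonpos (by positivity)
            (by linarith [add_le_dB z.1 y z.2 s]) (by linarith)
        rw [div_eq_mul_inv, ← Real.rpow_neg hd.le, hsum, neg_add, Real.rpow_add hd]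
        calc z.2 ^ α * (dB z.1 z.2 y s ^ (-γ₁) * dB z.1 z.2 y s ^ (-γ₂))
            ≤ z.2 ^ α * ((2 ^ γ₁ * (s + dist z.1 y) ^ (-γ₁)) * (s + z.2) ^ (-γ₂)) := by gcongr
          _ = _ := by ring
    _ = ENNReal.ofReal (2 ^ γ₁) * ((∫⁻ x : Euc n, ENNReal.ofReal ((s + dist x y) ^ (-γ₁))) *
          ∫⁻ t in Ioi (0 : ℝ), ENNReal.ofReal (t ^ α * (s + t) ^ (-γ₂))) := by
        rw [lintegral_const_mul' _ _ ENNReal.ofReal_ne_top, baseM]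
        congr 1
        exact lintegral_prod_mul (f := fun x : Euc n => ENNReal.ofReal ((s + dist x y) ^ (-γ₁)))
          (g := fun t : ℝ => ENNReal.ofReal (t ^ α * (s + t) ^ (-γ₂)))
          (by fun_prop) (by fun_prop)
    _ ≤ ENNReal.ofReal (2 ^ γ₁) * (ENNReal.ofReal (K * s ^ ((n : ℝ) - γ₁)) *
          ENNReal.ofReal (L * s ^ (α + 1 - γ₂))) := by
        rw [lintegral_dist_add_rpow n (by linarith) y hs]
        gcongr
        exact lintegral_rpow_mul_add_rpow_le hα (by linarith) hs
    _ ≤ _ := by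
        rw [← ENNReal.ofReal_mul (by positivity), ← ENNReal.ofReal_mul (by positivity)]
        refine ENNReal.ofReal_le_ofReal ?_
        rw [show α + n + 1 - γ = ((n : ℝ) - γ₁) + (α + 1 - γ₂) by rw [hsum]; ring,
          Real.rpow_add hs]
        have h3 : 0 < s ^ ((n : ℝ) - γ₁) * s ^ (α + 1 - γ₂) := by positivity
        linarith

lemma exists_lintegral_mLam_rpow_div_dB_le (n : ℕ) {α l γ : ℝ} (hα : -1 < α + l)
    (hγ : (n : ℝ) + 1 + (α + l) < γ) :
    ∃ C : ℝ, 0 < C ∧ ∀ (y : Euc n) (s : ℝ), 0 < s →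
      ∫⁻ z, ENNReal.ofReal (z.2 ^ α / dB z.1 z.2 y s ^ γ) ∂mLam n l ≤
        ENNReal.ofReal (C * s ^ (α + l + n + 1 - γ)) := by
  obtain ⟨C, hC, h⟩ := exists_lintegral_rpow_div_dB_le n hα hγ
  refine ⟨C, hC, fun y s hs => ?_⟩
  rw [lintegral_mLam]
  refine le_trans (lintegral_mono_ae ?_) (h y s hs)
  filter_upwards [ae_baseM_pos n] with z hz
  rw [← ENNReal.ofReal_mul (by positivity), Real.rpow_add hz]
  exact le_of_eq (by congr 1; ring)

lemma lintegral_pi_prod {E : Type*} [MeasurableSpace E] :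
    ∀ {m : ℕ} (μ : Fin m → Measure E) [∀ j, SigmaFinite (μ j)] (f : Fin m → E → ℝ≥0∞),
      (∀ j, Measurable (f j)) →
      ∫⁻ z, ∏ j, f j (z j) ∂Measure.pi μ = ∏ j, ∫⁻ x, f j x ∂μ j := by
  intro m
  induction m with
  | zero => intro μ _ f hf; simp
  | succ m ih =>
    intro μ _ f hf
    have hmeas : Measurable fun z : Fin (m + 1) → E => ∏ j, f j (z j) := by fun_prop
    rw [← (measurePreserving_piFinSuccAbove μ 0).symm.lintegral_comp hmeas]
    simp only [MeasurableEquiv.piFinSuccAbove_symm_apply, Fin.prod_univ_succ,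
      Fin.insertNthEquiv, Equiv.coe_fn_mk, Fin.insertNth_zero', Fin.cons_zero, Fin.cons_succ,
      Fin.zero_succAbove]
    rw [lintegral_prod_mul (f := f 0) (g := fun z : Fin m → E => ∏ j, f j.succ (z j))
      (hf 0).aemeasurable
      (Finset.measurable_fun_prod _ fun j _ => (hf j.succ).comp (measurable_pi_apply j)).aemeasurable,
      ih (fun j => μ j.succ) _ fun j => hf j.succ]

lemma ae_pi_mLam_pos (n : ℕ) {m : ℕ} (s : Fin m → ℝ) :
    ∀ᵐ z : Fin m → Euc n × ℝ ∂(Measure.pi fun j => mLam n (s j)), ∀ j, 0 < (z j).2 :=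
  Filter.eventually_all.2 fun j =>
    (Measure.tendsto_eval_ae_ae (μ := fun j => mLam n (s j)) (i := j)).eventually
      (ae_mLam_pos n (s j))

/-- The kernel of the operator `S_{a,b}`, up to the powers of the heights of `z` and `w`. -/
def prodKernel {n m : ℕ} (a b : Fin m → ℝ) (z : Fin m → Euc n × ℝ) (w : Euc n × ℝ) : ℝ :=
  ∏ j, w.2 ^ b j / dB (z j).1 (z j).2 w.1 w.2 ^ (a j + b j)

section

variable {n m : ℕ} {a b : Fin m → ℝ} {z : Fin m → Euc n × ℝ}

lemma prodKernel_pos (hz : ∀ j, 0 < (z j).2) {w : Euc n × ℝ} (hw : 0 < w.2) :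
    0 < prodKernel a b z w :=
  Finset.prod_pos fun j _ =>
    div_pos (Real.rpow_pos_of_pos hw _) (Real.rpow_pos_of_pos (dB_pos _ _ (hz j) hw) _)

lemma measurable_prodKernel : Measurable (prodKernel a b z) := by
  refine Finset.measurable_fun_prod _ fun j _ => ?_
  exact (measurable_snd.pow_const _).div
    (((measurable_dB n).comp (measurable_const.prodMk measurable_id)).pow_const _)

lemma prodKernel_le_mul (hab : ∀ j, 0 < a j + b j) (hz : ∀ j, 0 < (z j).2)
    {w v : Euc n × ℝ} (hw : 0 < w.2) (hwv : dist (pt v.1 v.2) (pt w.1 w.2) ≤ w.2 / 2) :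
    prodKernel a b z w ≤ (∏ j, 2 ^ (|b j| + (a j + b j))) * prodKernel a b z v := by
  have hh := abs_le.1 ((abs_tp_sub_tp_le_dist (pt v.1 v.2) (pt w.1 w.2)).trans hwv)
  simp only [tp_pt] at hh
  have hv : 0 < v.2 := by linarith
  rw [prodKernel, prodKernel, ← Finset.prod_mul_distrib]
  refine Finset.prod_le_prod (fun j _ => ?_) fun j _ => ?_
  · have := dB_pos (z j).1 w.1 (hz j) hw
    positivity
  have hdw := dB_pos (z j).1 w.1 (hz j) hw
  have hdv := dB_pos (z j).1 v.1 (hz j) hv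
  have hd : dB (z j).1 (z j).2 v.1 v.2 ≤ 2 * dB (z j).1 (z j).2 w.1 w.2 := by
    have h1 : dB (z j).1 (z j).2 v.1 v.2 ≤
        dB (z j).1 (z j).2 w.1 w.2 + dist (pt w.1 (-w.2)) (pt v.1 (-v.2)) := dist_triangle _ _ _
    have h2 : dist (pt w.1 (-w.2)) (pt v.1 (-v.2)) = dist (pt v.1 v.2) (pt w.1 w.2) := by
      rw [dist_pt_pt, dist_pt_pt, dist_comm w.1]
      congr 2
      ring
    linarith [add_le_dB (z j).1 w.1 (z j).2 w.2, hz j]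
  have hb : w.2 ^ b j ≤ 2 ^ |b j| * v.2 ^ b j := by
    rcases le_total 0 (b j) with h | h
    · rw [abs_of_nonneg h, ← Real.mul_rpow zero_le_two hv.le]
      exact Real.rpow_le_rpow hw.le (by linarith) h
    · have h3 : (2 : ℝ) ^ |b j| * v.2 ^ b j = (v.2 / 2) ^ b j := by
        rw [abs_of_nonpos h, Real.rpow_neg zero_le_two, Real.div_rpow hv.le zero_le_two]
        field_simp
      rw [h3]
      exact Real.rpow_le_rpow_of_nonpos (by positivity) (by linarith) h
  have hdr : dB (z j).1 (z j).2 v.1 v.2 ^ (a j + b j) ≤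
      2 ^ (a j + b j) * dB (z j).1 (z j).2 w.1 w.2 ^ (a j + b j) := by
    rw [← Real.mul_rpow zero_le_two hdw.le]
    exact Real.rpow_le_rpow hdv.le hd (hab j).le
  rw [Real.rpow_add zero_lt_two, div_le_iff₀ (by positivity)]
  have h4 : (1 : ℝ) ≤ 2 ^ (a j + b j) * dB (z j).1 (z j).2 w.1 w.2 ^ (a j + b j) /
      dB (z j).1 (z j).2 v.1 v.2 ^ (a j + b j) := by
    rw [le_div_iff₀ (by positivity), one_mul]
    exact hdr
  calc w.2 ^ b j ≤ (2 ^ |b j| * v.2 ^ b j) * 1 := by rw [mul_one]; exact hb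
    _ ≤ (2 ^ |b j| * v.2 ^ b j) * _ := mul_le_mul_of_nonneg_left h4 (by positivity)
    _ = _ := by ring

lemma integrand_eq (f : Euc (n + 1) → ℝ) {w : Euc n × ℝ} (hw : 0 < w.2) :
    f (pt w.1 w.2) * w.2 ^ (-(n : ℝ) - 1 + ∑ j, b j) /
      ∏ j, (dB (z j).1 (z j).2 w.1 w.2) ^ (a j + b j) =
    f (pt w.1 w.2) * prodKernel a b z w * w.2 ^ (-(n : ℝ) - 1) := by
  rw [prodKernel, Finset.prod_div_distrib, Real.rpow_add hw, ← Real.rpow_sum_of_pos hw]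
  ring

end

lemma exists_rpow_lintegral_prodKernel_le {n m : ℕ} {p : ℝ} (hp0 : 0 < p) (hp1 : p ≤ 1)
    {a b : Fin m → ℝ} (hab : ∀ j, 0 < a j + b j) :
    ∃ D : ℝ, 0 < D ∧ ∀ f : Euc (n + 1) → ℝ, HarmonicOnE f (upperHS n) →
      ∀ z : Fin m → Euc n × ℝ, (∀ j, 0 < (z j).2) →
      (∫⁻ w, ENNReal.ofReal (|f (pt w.1 w.2)| * prodKernel a b z w) *
          ENNReal.ofReal (w.2 ^ (-(n : ℝ) - 1)) ∂baseM n) ^ p ≤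
        ENNReal.ofReal D * ∫⁻ w, ENNReal.ofReal (|f (pt w.1 w.2)| * prodKernel a b z w) ^ p *
          ENNReal.ofReal (w.2 ^ (-(n : ℝ) - 1)) ∂baseM n := by
  have hA : 0 < ∏ j, (2 : ℝ) ^ (|b j| + (a j + b j)) :=
    Finset.prod_pos fun j _ => Real.rpow_pos_of_pos zero_lt_two _
  obtain ⟨D, hD, h⟩ := exists_ofReal_rpow_le_lintegral_upperHS n hp0 hp1 hA
  refine ⟨D ^ (1 - p), by positivity, fun f hf z hz => ?_⟩
  rw [← ENNReal.ofReal_rpow_of_nonneg hD.le (by linarith)]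
  refine rpow_lintegral_mul_le hp0 hp1 (by simpa using hD) ENNReal.ofReal_ne_top ?_
  filter_upwards [ae_baseM_pos n] with w hw
  have key := h f (fun v => prodKernel a b z (xp v, tp v)) hf
    (fun v hv => (prodKernel_pos hz (w := (xp v, tp v)) hv).le)
    (fun v hv u huv => prodKernel_le_mul hab hz (w := (xp v, tp v)) (v := (xp u, tp u)) hv
      (by simpa only [pt_xp_tp] using huv))
    (pt w.1 w.2) (by simpa [upperHS] using hw)
  rw [setLIntegral_upperHS] at key
  simpa only [tp_pt, xp_pt] using key

lemma prodKernel_rpow_eq {n m : ℕ} {a b : Fin m → ℝ} {z : Fin m → Euc n × ℝ} {p : ℝ}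
    (hz : ∀ j, 0 < (z j).2) {w : Euc n × ℝ} (hw : 0 < w.2) :
    prodKernel a b z w ^ p =
      ∏ j, w.2 ^ (p * b j) / dB (z j).1 (z j).2 w.1 w.2 ^ (p * (a j + b j)) := by
  have hd := fun j => dB_pos (z j).1 w.1 (hz j) hw
  rw [prodKernel, ← Real.finsetProd_rpow _ _ fun j _ => by have := hd j; positivity]
  refine Finset.prod_congr rfl fun j _ => ?_
  have := hd j
  rw [Real.div_rpow (by positivity) (by positivity), ← Real.rpow_mul hw.le,
    ← Real.rpow_mul this.le, mul_comm p, mul_comm p]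

lemma prod_rpow_mul_eq {n m : ℕ} {s : Fin m → ℝ} {lam t : ℝ} (ht : 0 < t)
    (hlam : lam = ((m : ℝ) - 1) * ((n : ℝ) + 1) + ∑ j, s j) :
    (∏ j, t ^ ((n : ℝ) + 1 + s j)) * t ^ (-(n : ℝ) - 1) = t ^ lam := by
  rw [← Real.rpow_sum_of_pos ht, ← Real.rpow_add ht, hlam, Finset.sum_add_distrib]
  congr 1
  simp
  ring

lemma prodKernel_rpow_mul_le {n m : ℕ} {a b s : Fin m → ℝ} {z : Fin m → Euc n × ℝ} {p lam : ℝ}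
    (ha : ∀ j, p * a j > -1 - s j) (hb : ∀ j, p * b j > (n : ℝ) + 1 + s j)
    (hlam : lam = ((m : ℝ) - 1) * ((n : ℝ) + 1) + ∑ j, s j)
    (hz : ∀ j, 0 < (z j).2) {w : Euc n × ℝ} (hw : 0 < w.2) :
    prodKernel a b z w ^ p * w.2 ^ (-(n : ℝ) - 1) ≤
      (∏ j, (z j).2 ^ (-(p * a j + n + 1 + s j))) * w.2 ^ lam := by
  rw [prodKernel_rpow_eq hz hw, ← prod_rpow_mul_eq hw hlam, ← mul_assoc,
    ← Finset.prod_mul_distrib]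
  refine mul_le_mul_of_nonneg_right ?_ (by positivity)
  refine Finset.prod_le_prod (fun j _ => ?_) fun j _ => ?_
  · have := dB_pos (z j).1 w.1 (hz j) hw
    positivity
  have hd := dB_pos (z j).1 w.1 (hz j) hw
  have hzj := hz j
  have hle := add_le_dB (z j).1 w.1 (z j).2 w.2
  have hn : (0 : ℝ) ≤ n := Nat.cast_nonneg n
  have h1 : (z j).2 ^ (p * a j + n + 1 + s j) * w.2 ^ (p * b j - (n + 1 + s j)) ≤
      dB (z j).1 (z j).2 w.1 w.2 ^ (p * (a j + b j)) := by
    rw [show p * (a j + b j) = (p * a j + n + 1 + s j) + (p * b j - (n + 1 + s j)) by ring,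
      Real.rpow_add hd]
    refine mul_le_mul (Real.rpow_le_rpow hzj.le (by linarith) ?_)
      (Real.rpow_le_rpow hw.le (by linarith) ?_) (by positivity) (by positivity)
    · linarith [ha j]
    · linarith [hb j]
  rw [div_le_iff₀ (by positivity)]
  calc w.2 ^ (p * b j) = (z j).2 ^ (-(p * a j + n + 1 + s j)) * w.2 ^ ((n : ℝ) + 1 + s j) *
        ((z j).2 ^ (p * a j + n + 1 + s j) * w.2 ^ (p * b j - (n + 1 + s j))) := by
        rw [Real.rpow_neg hzj.le, Real.rpow_sub hw]
        field_simp
    _ ≤ _ := by gcongr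

lemma aemeasurable_comp_pt {n : ℕ} {f : Euc (n + 1) → ℝ} (hf : HarmonicOnE f (upperHS n)) :
    AEMeasurable (fun w : Euc n × ℝ => f (pt w.1 w.2)) (baseM n) := by
  rw [baseM_eq]
  exact (hf.1.continuousOn.comp continuous_pt.continuousOn fun _ h => h).aemeasurable
    ((measurableEmbedding_pt n).measurable (measurableSet_upperHS n))

lemma normAp_eq (n : ℕ) (f : Euc (n + 1) → ℝ) (p l : ℝ) :
    normAp n f p l = ∫⁻ w, ENNReal.ofReal (|f (pt w.1 w.2)| ^ p * w.2 ^ l) ∂baseM n := by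
  rw [normAp, lintegral_mLam]
  refine lintegral_congr_ae ?_
  filter_upwards [ae_baseM_pos n] with w hw
  rw [← ENNReal.ofReal_mul (by positivity), mul_comm]

lemma ofReal_mul_prodKernel_rpow_mul {n m : ℕ} {a b : Fin m → ℝ} {z : Fin m → Euc n × ℝ} {p : ℝ}
    (hp0 : 0 < p) (hz : ∀ j, 0 < (z j).2) {w : Euc n × ℝ} (hw : 0 < w.2) (c : ℝ) :
    ENNReal.ofReal (|c| * prodKernel a b z w) ^ p * ENNReal.ofReal (w.2 ^ (-(n : ℝ) - 1)) =
      ENNReal.ofReal (|c| ^ p * (prodKernel a b z w ^ p * w.2 ^ (-(n : ℝ) - 1))) := by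
  have hk := (prodKernel_pos (a := a) (b := b) hz hw).le
  rw [ENNReal.ofReal_rpow_of_nonneg (by positivity) hp0.le, ← ENNReal.ofReal_mul (by positivity),
    Real.mul_rpow (abs_nonneg _) hk, mul_assoc]

lemma lintegral_prodKernel_rpow_lt_top {n m : ℕ} {a b s : Fin m → ℝ} {z : Fin m → Euc n × ℝ}
    {p lam : ℝ} (hp0 : 0 < p)
    (ha : ∀ j, p * a j > -1 - s j) (hb : ∀ j, p * b j > (n : ℝ) + 1 + s j)
    (hlam : lam = ((m : ℝ) - 1) * ((n : ℝ) + 1) + ∑ j, s j)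
    (hz : ∀ j, 0 < (z j).2) {f : Euc (n + 1) → ℝ} (hf : normAp n f p lam < ⊤) :
    ∫⁻ w, ENNReal.ofReal (|f (pt w.1 w.2)| * prodKernel a b z w) ^ p *
      ENNReal.ofReal (w.2 ^ (-(n : ℝ) - 1)) ∂baseM n < ⊤ := by
  set c := ∏ j, (z j).2 ^ (-(p * a j + n + 1 + s j)) with hc
  have hc0 : 0 ≤ c := Finset.prod_nonneg fun j _ => Real.rpow_nonneg (hz j).le _
  refine lt_of_le_of_lt ?_ (ENNReal.mul_lt_top (ENNReal.ofReal_lt_top (r := c)) hf)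
  rw [normAp_eq, ← lintegral_const_mul' _ _ ENNReal.ofReal_ne_top]
  refine lintegral_mono_ae ?_
  filter_upwards [ae_baseM_pos n] with w hw
  rw [ofReal_mul_prodKernel_rpow_mul hp0 hz hw, ← ENNReal.ofReal_mul hc0]
  refine ENNReal.ofReal_le_ofReal ?_
  have h1 := prodKernel_rpow_mul_le ha hb hlam hz hw
  calc |f (pt w.1 w.2)| ^ p * (prodKernel a b z w ^ p * w.2 ^ (-(n : ℝ) - 1))
      ≤ |f (pt w.1 w.2)| ^ p * (c * w.2 ^ lam) := by gcongr
    _ = _ := by ring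

lemma exists_lintegral_prodKernel_rpow_le {n m : ℕ} {a b s : Fin m → ℝ} {p lam : ℝ}
    (hp0 : 0 < p)
    (ha : ∀ j, p * a j > -1 - s j) (hb : ∀ j, p * b j > (n : ℝ) + 1 + s j)
    (hlam : lam = ((m : ℝ) - 1) * ((n : ℝ) + 1) + ∑ j, s j) :
    ∃ C : ℝ, 0 < C ∧ ∀ f : Euc (n + 1) → ℝ, HarmonicOnE f (upperHS n) →
      ∫⁻ z, ENNReal.ofReal (∏ j, (z j).2 ^ a j) ^ p *
        ∫⁻ w, ENNReal.ofReal (|f (pt w.1 w.2)| * prodKernel a b z w) ^ p *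
          ENNReal.ofReal (w.2 ^ (-(n : ℝ) - 1)) ∂baseM n
        ∂(Measure.pi fun j => mLam n (s j)) ≤ ENNReal.ofReal C * normAp n f p lam := by
  have hker := fun j => exists_lintegral_mLam_rpow_div_dB_le n (α := p * a j) (l := s j)
    (γ := p * (a j + b j)) (by linarith [ha j]) (by linarith [hb j])
  choose C hC hCle using hker
  refine ⟨∏ j, C j, Finset.prod_pos fun j _ => hC j, fun f hf => ?_⟩
  set G : Euc n × ℝ → ℝ≥0∞ := fun w =>
    ENNReal.ofReal (|f (pt w.1 w.2)| ^ p * ((∏ j, w.2 ^ (p * b j)) * w.2 ^ (-(n : ℝ) - 1))) with hG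
  set k : Fin m → Euc n × ℝ → Euc n × ℝ → ℝ≥0∞ := fun j x w =>
    ENNReal.ofReal (x.2 ^ (p * a j) / dB x.1 x.2 w.1 w.2 ^ (p * (a j + b j))) with hk
  have hkm : ∀ j, Measurable (Function.uncurry (k j)) := fun j =>
    (((measurable_snd.comp measurable_fst).pow_const _).div
      ((measurable_dB n).pow_const _)).ennreal_ofReal
  have hGm : AEMeasurable G (baseM n) := by
    have := aemeasurable_comp_pt hf
    exact ((this.norm.pow_const p).mul
      (by fun_prop : Measurable fun w : Euc n × ℝ =>
        (∏ j, w.2 ^ (p * b j)) * w.2 ^ (-(n : ℝ) - 1)).aemeasurable).ennreal_ofReal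
  calc ∫⁻ z, ENNReal.ofReal (∏ j, (z j).2 ^ a j) ^ p *
        ∫⁻ w, ENNReal.ofReal (|f (pt w.1 w.2)| * prodKernel a b z w) ^ p *
          ENNReal.ofReal (w.2 ^ (-(n : ℝ) - 1)) ∂baseM n
        ∂(Measure.pi fun j => mLam n (s j))
      = ∫⁻ z, ∫⁻ w, G w * ∏ j, k j (z j) w ∂baseM n
          ∂(Measure.pi fun j => mLam n (s j)) := by
        refine lintegral_congr_ae ?_
        filter_upwards [ae_pi_mLam_pos n s] with z hz
        rw [← lintegral_const_mul' _ _
          (ENNReal.rpow_ne_top_of_nonneg hp0.le ENNReal.ofReal_ne_top)]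
        refine lintegral_congr_ae ?_
        filter_upwards [ae_baseM_pos n] with w hw
        have hd := fun j => dB_pos (z j).1 w.1 (hz j) hw
        have ht : ∀ j, 0 ≤ (z j).2 ^ a j := fun j => Real.rpow_nonneg (hz j).le _
        rw [ofReal_mul_prodKernel_rpow_mul hp0 hz hw, prodKernel_rpow_eq hz hw,
          ENNReal.ofReal_rpow_of_nonneg (Finset.prod_nonneg fun j _ => ht j) hp0.le,
          ← Real.finsetProd_rpow _ _ fun j _ => ht j, hG, hk]
        simp only
        rw [← ENNReal.ofReal_prod_of_nonneg fun j _ => div_nonneg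
            (Real.rpow_nonneg (hz j).le _) (Real.rpow_nonneg (hd j).le _),
          ← ENNReal.ofReal_mul (Finset.prod_nonneg fun j _ => Real.rpow_nonneg (ht j) _),
          ← ENNReal.ofReal_mul (mul_nonneg (by positivity)
            (mul_nonneg (Finset.prod_nonneg fun j _ => by positivity) (by positivity))),
          Finset.prod_div_distrib, Finset.prod_div_distrib,
          Finset.prod_congr rfl fun j _ =>
            show ((z j).2 ^ a j) ^ p = (z j).2 ^ (p * a j) by
              rw [← Real.rpow_mul (hz j).le, mul_comm]]
        congr 1
        ring
    _ = ∫⁻ w, ∫⁻ z, G w * ∏ j, k j (z j) w ∂(Measure.pi fun j => mLam n (s j)) ∂baseM n := by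
        refine lintegral_lintegral_swap (AEMeasurable.mul (hGm.comp_snd) ?_)
        refine (Finset.measurable_fun_prod _ fun j _ => ?_).aemeasurable
        have hmk : Measurable fun q : (Fin m → Euc n × ℝ) × (Euc n × ℝ) => (q.1 j, q.2) := by
          fun_prop
        exact (hkm j).comp hmk
    _ ≤ ∫⁻ w, ENNReal.ofReal (∏ j, C j) *
          ENNReal.ofReal (|f (pt w.1 w.2)| ^ p * w.2 ^ lam) ∂baseM n := by
        refine lintegral_mono_ae ?_
        filter_upwards [ae_baseM_pos n] with w hw
        rw [lintegral_const_mul' _ _ ENNReal.ofReal_ne_top,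
          lintegral_pi_prod (fun j => mLam n (s j)) (fun j x => k j x w)
            fun j => (hkm j).comp (measurable_id.prodMk measurable_const)]
        have hC0 : 0 ≤ ∏ j, C j := Finset.prod_nonneg fun j _ => (hC j).le
        calc G w * ∏ j, ∫⁻ x, k j x w ∂mLam n (s j)
            ≤ G w * ∏ j, ENNReal.ofReal (C j * w.2 ^ (p * a j + s j + n + 1 - p * (a j + b j))) := by
              gcongr with j
              exact hCle j w.1 w.2 hw
          _ = _ := by
              rw [← ENNReal.ofReal_prod_of_nonneg fun j _ =>
                  mul_nonneg (hC j).le (Real.rpow_nonneg hw.le _), hG]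
              simp only
              rw [← ENNReal.ofReal_mul (mul_nonneg (by positivity)
                  (mul_nonneg (Finset.prod_nonneg fun j _ => by positivity) (by positivity))),
                ← ENNReal.ofReal_mul hC0, ← prod_rpow_mul_eq hw hlam, Finset.prod_mul_distrib,
                Finset.prod_congr rfl fun j _ =>
                  show w.2 ^ ((n : ℝ) + 1 + s j) = w.2 ^ (p * b j) *
                      w.2 ^ (p * a j + s j + n + 1 - p * (a j + b j)) by
                    rw [← Real.rpow_add hw]; congr 1; ring,
                Finset.prod_mul_distrib]
              congr 1
              ring
    _ = ENNReal.ofReal (∏ j, C j) * normAp n f p lam := by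
        rw [lintegral_const_mul' _ _ ENNReal.ofReal_ne_top, normAp_eq]

/-- boundedness of the operator S_{a,b}. -/
theorem stmt6 (n m : ℕ) (hn : 1 ≤ n) (hm : 1 ≤ m) (p : ℝ) (hp0 : 0 < p) (hp1 : p ≤ 1)
    (a b s : Fin m → ℝ) (hs : ∀ j, -1 < s j)
    (ha : ∀ j, p * a j > -1 - s j) (hb : ∀ j, p * b j > (n : ℝ) + 1 + s j)
    (lam : ℝ) (hlam : lam = ((m : ℝ) - 1) * ((n : ℝ) + 1) + ∑ j, s j) :
    ∃ C : ℝ, 0 < C ∧ ∀ f : Euc (n + 1) → ℝ, memAp n f p lam →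
      (∀ z : Fin m → Euc n × ℝ, (∀ j, 0 < (z j).2) →
        Integrable (fun w : Euc n × ℝ =>
          f (pt w.1 w.2) * w.2 ^ (-(n : ℝ) - 1 + ∑ j, b j) /
            ∏ j, (dB (z j).1 (z j).2 w.1 w.2) ^ (a j + b j)) (baseM n)) ∧
      (∫⁻ z : Fin m → Euc n × ℝ, ENNReal.ofReal (|Sab n m a b f z| ^ p)
          ∂(Measure.pi fun j => mLam n (s j))) ≤
        ENNReal.ofReal C * normAp n f p lam := by
  have hab : ∀ j, 0 < a j + b j := fun j =>
    pos_of_mul_pos_right (by nlinarith [ha j, hb j, (Nat.cast_nonneg n : (0 : ℝ) ≤ n)]) hp0.le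
  obtain ⟨D, hD, hDle⟩ := exists_rpow_lintegral_prodKernel_le (n := n) hp0 hp1 hab
  obtain ⟨C, hC, hCle⟩ := exists_lintegral_prodKernel_rpow_le hp0 ha hb hlam
  refine ⟨D * C, by positivity, fun f hf => ?_⟩
  have henorm : ∀ z : Fin m → Euc n × ℝ, (∀ j, 0 < (z j).2) →
      ∫⁻ w, ‖f (pt w.1 w.2) * w.2 ^ (-(n : ℝ) - 1 + ∑ j, b j) /
        ∏ j, (dB (z j).1 (z j).2 w.1 w.2) ^ (a j + b j)‖ₑ ∂baseM n =
      ∫⁻ w, ENNReal.ofReal (|f (pt w.1 w.2)| * prodKernel a b z w) *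
        ENNReal.ofReal (w.2 ^ (-(n : ℝ) - 1)) ∂baseM n := by
    intro z hz
    refine lintegral_congr_ae ?_
    filter_upwards [ae_baseM_pos n] with w hw
    have hk := prodKernel_pos (a := a) (b := b) hz hw
    rw [integrand_eq f hw, ← ENNReal.ofReal_mul (by positivity), ← ofReal_norm,
      norm_mul, norm_mul, Real.norm_eq_abs, Real.norm_of_nonneg hk.le,
      Real.norm_of_nonneg (by positivity)]
  refine ⟨fun z hz => ⟨?_, ?_⟩, ?_⟩
  · have h1 : AEMeasurable (fun w : Euc n × ℝ =>
        f (pt w.1 w.2) * prodKernel a b z w * w.2 ^ (-(n : ℝ) - 1)) (baseM n) :=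
      ((aemeasurable_comp_pt hf.1).mul measurable_prodKernel.aemeasurable).mul
        (by fun_prop)
    refine (h1.congr ?_).aestronglyMeasurable
    filter_upwards [ae_baseM_pos n] with w hw
    exact (integrand_eq f hw).symm
  · rw [hasFiniteIntegral_iff_enorm, henorm z hz,
      ← ENNReal.rpow_lt_top_iff_of_pos hp0]
    exact (hDle f hf.1 z hz).trans_lt (ENNReal.mul_lt_top ENNReal.ofReal_lt_top
      (lintegral_prodKernel_rpow_lt_top hp0 ha hb hlam hz hf.2))
  · rw [ENNReal.ofReal_mul hD.le, mul_assoc]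
    refine le_trans ?_ (mul_le_mul_right (hCle f hf.1) (ENNReal.ofReal D))
    rw [← lintegral_const_mul' _ _ ENNReal.ofReal_ne_top]
    refine lintegral_mono_ae ?_
    filter_upwards [ae_pi_mLam_pos n s] with z hz
    have hT : 0 ≤ ∏ j, (z j).2 ^ a j := Finset.prod_nonneg fun j _ => Real.rpow_nonneg (hz j).le _
    rw [← ENNReal.ofReal_rpow_of_nonneg (abs_nonneg _) hp0.le, Sab, abs_mul, abs_of_nonneg hT,
      ENNReal.ofReal_mul hT, ENNReal.mul_rpow_of_nonneg _ _ hp0.le, mul_left_comm]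
    gcongr
    refine le_trans (ENNReal.rpow_le_rpow ?_ hp0.le) (hDle f hf.1 z hz)
    rw [← henorm z hz, ← Real.norm_eq_abs, ofReal_norm]
    exact enorm_integral_le_lintegral_enorm _

end
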